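/- arXiv:0811.3276 — 2 statements merged into one kernel-verified Lean document; each statement's English description precedes it below -/
import Mathlib

section
/- If X is a second countable locally compact topological space, then ML(X), with the subspace topology induced by the Fell topology τ_s on L(X), is a Baire space. -/
open Filter Set Topology TopologicalSpace

universe u v

/-- The lower semifinite topology `τ_w` on the hyperspace `F(X)` of closed subsets of `X`:
it is generated by the base of all sets `U(∅,Φ)` with `Φ` a finite family of open sets. -/
def lowTop (X : Type u) [TopologicalSpace X] : TopologicalSpace (Closeds X) :=
  TopologicalSpace.generateFrom
    {U | ∃ Φ : Finset (Set X), (∀ O ∈ Φ, IsOpen O) ∧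
      U = {A : Closeds X | ∀ O ∈ Φ, ((A : Set X) ∩ O).Nonempty}}

/-- The Fell topology `τ_s` on the hyperspace `F(X)` of closed subsets of `X`:
it is generated by the base of all sets `U(C,Φ)` with `C` compact and `Φ` a finite
family of open sets. -/
def fellTop (X : Type u) [TopologicalSpace X] : TopologicalSpace (Closeds X) :=
  TopologicalSpace.generateFrom
    {U | ∃ (C : Set X) (Φ : Finset (Set X)), IsCompact C ∧ (∀ O ∈ Φ, IsOpen O) ∧
      U = {A : Closeds X | (A : Set X) ∩ C = ∅ ∧ ∀ O ∈ Φ, ((A : Set X) ∩ O).Nonempty}}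

/-- `L ⊆ X` is a limit set if there is a net (equivalently, a `NeBot` filter)
converging to every point of `L`. -/
def IsLimitSet {X : Type u} [TopologicalSpace X] (L : Set X) : Prop :=
  ∃ F : Filter X, F.NeBot ∧ ∀ x ∈ L, F ≤ nhds x

/-- A maximal limit set: a limit set maximal with respect to inclusion among all limit sets. -/
def IsMaxLimitSet {X : Type u} [TopologicalSpace X] (L : Set X) : Prop :=
  IsLimitSet L ∧ ∀ M : Set X, IsLimitSet M → L ⊆ M → M = L

/-- `L(X)`: the collection of all closed limit sets of `X`. -/
abbrev LX (X : Type u) [TopologicalSpace X] := {A : Closeds X // IsLimitSet (A : Set X)}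

/-- `ML(X)`: the collection of all maximal limit sets of `X` (each of these is closed). -/
abbrev MLX (X : Type u) [TopologicalSpace X] := {A : Closeds X // IsMaxLimitSet (A : Set X)}

/-- The subspace topology induced by `τ_w` on `L(X)`. -/
def lowTopL (X : Type u) [TopologicalSpace X] : TopologicalSpace (LX X) :=
  (lowTop X).induced Subtype.val

/-- The subspace topology induced by `τ_s` on `L(X)`. -/
def fellTopL (X : Type u) [TopologicalSpace X] : TopologicalSpace (LX X) :=
  (fellTop X).induced Subtype.val

/-- The subspace topology induced by `τ_w` on `ML(X)`. -/
def lowTopML (X : Type u) [TopologicalSpace X] : TopologicalSpace (MLX X) :=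
  (lowTop X).induced Subtype.val

/-- The subspace topology induced by `τ_s` on `ML(X)`. -/
def fellTopML (X : Type u) [TopologicalSpace X] : TopologicalSpace (MLX X) :=
  (fellTop X).induced Subtype.val

/-- A point `y` is separated in `Y` if every `z ∉ closure {y}` admits a neighbourhood
disjoint from some neighbourhood of `y`. -/
def IsSeparatedPt {Y : Type v} [TopologicalSpace Y] (y : Y) : Prop :=
  ∀ z : Y, z ∉ closure {y} → ∃ U ∈ nhds y, ∃ V ∈ nhds z, Disjoint U V

section FellTopology

variable {X : Type u} [TopologicalSpace X]

attribute [local instance] fellTop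

theorem isOpen_setOf_inter_compact_eq_empty {C : Set X} (hC : IsCompact C) :
    IsOpen {A : Closeds X | (A : Set X) ∩ C = ∅} :=
  isOpen_generateFrom_of_mem ⟨C, ∅, hC, by simp, by simp⟩

theorem isOpen_setOf_forall_inter_nonempty {Φ : Finset (Set X)} (hΦ : ∀ O ∈ Φ, IsOpen O) :
    IsOpen {A : Closeds X | ∀ O ∈ Φ, ((A : Set X) ∩ O).Nonempty} :=
  isOpen_generateFrom_of_mem ⟨∅, Φ, isCompact_empty, hΦ, by simp⟩

theorem isOpen_setOf_inter_open_nonempty {O : Set X} (hO : IsOpen O) :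
    IsOpen {A : Closeds X | ((A : Set X) ∩ O).Nonempty} := by
  simpa using isOpen_setOf_forall_inter_nonempty (Φ := {O}) (by simpa using hO)

/-- The limit of an ultrafilter `𝒰` of closed sets in the Fell topology: the set of points all of
whose open neighbourhoods are met by `𝒰`-many closed sets. -/
def fellUltrafilterLim (𝒰 : Ultrafilter (Closeds X)) : Closeds X where
  carrier := {x | ∀ O : Set X, IsOpen O → x ∈ O → ∀ᶠ B : Closeds X in 𝒰, ((B : Set X) ∩ O).Nonempty}
  isClosed' := by
    refine isClosed_of_closure_subset fun x hx O hO hxO => ?_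
    obtain ⟨y, hyO, hy⟩ := mem_closure_iff.1 hx O hO hxO
    exact hy O hO hyO

theorem le_nhds_fellUltrafilterLim (𝒰 : Ultrafilter (Closeds X)) :
    (𝒰 : Filter (Closeds X)) ≤ 𝓝 (fellUltrafilterLim 𝒰) := by
  refine tendsto_id'.1 (tendsto_nhds_generateFrom_iff.2 ?_)
  rintro _ ⟨C, Φ, hC, hΦ, rfl⟩ ⟨hAC, hAΦ⟩
  have hmiss : ∀ᶠ B : Closeds X in (𝒰 : Filter (Closeds X)), (B : Set X) ∩ C = ∅ := by
    refine hC.induction_on (p := fun C => ∀ᶠ B : Closeds X in (𝒰 : Filter (Closeds X)), (B : Set X) ∩ C = ∅)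
      (by simp) ?_ ?_ ?_
    · intro s t hst ht
      filter_upwards [ht] with B hB
      exact subset_eq_empty (inter_subset_inter_right _ hst) hB
    · intro s t hs ht
      filter_upwards [hs, ht] with B hBs hBt
      rw [inter_union_distrib_left, hBs, hBt, union_empty]
    · intro x hx
      have hxA : x ∉ fellUltrafilterLim 𝒰 := fun h => (hAC ▸ ⟨h, hx⟩ : x ∈ (∅ : Set X))
      obtain ⟨O, hO, hxO, h⟩ : ∃ O : Set X, IsOpen O ∧ x ∈ O ∧
          ¬ ∀ᶠ B : Closeds X in (𝒰 : Filter (Closeds X)), ((B : Set X) ∩ O).Nonempty := by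
        by_contra! h
        exact hxA h
      refine ⟨O, mem_nhdsWithin_of_mem_nhds (hO.mem_nhds hxO), ?_⟩
      filter_upwards [Ultrafilter.eventually_not.2 h] with B hB
      exact not_nonempty_iff_eq_empty.1 hB
  have hhit : ∀ᶠ B : Closeds X in (𝒰 : Filter (Closeds X)), ∀ O ∈ Φ, ((B : Set X) ∩ O).Nonempty := by
    refine (Filter.eventually_all_finset Φ).2 fun O hO => ?_
    obtain ⟨x, hxA, hxO⟩ := hAΦ O hO
    exact hxA O (hΦ O hO) hxO
  exact hmiss.and hhit

theorem compactSpace_fellTop : CompactSpace (Closeds X) :=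
  ⟨isCompact_iff_ultrafilter_le_nhds.2 fun 𝒰 _ =>
    ⟨fellUltrafilterLim 𝒰, mem_univ _, le_nhds_fellUltrafilterLim 𝒰⟩⟩

theorem exists_isOpen_separating_of_not_le [LocallyCompactSpace X] {A B : Closeds X}
    (h : ¬ A ≤ B) :
    ∃ U V : Set (Closeds X), IsOpen U ∧ IsOpen V ∧ A ∈ U ∧ B ∈ V ∧
      ∀ A' ∈ U, ∀ B' ∈ V, ¬ A' ≤ B' := by
  obtain ⟨x, hxA, hxB⟩ := not_subset.1 h
  obtain ⟨C, hC, hCB, hCc⟩ := local_compact_nhds (B.isClosed.isOpen_compl.mem_nhds hxB)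
  refine ⟨_, _, isOpen_setOf_inter_open_nonempty isOpen_interior,
    isOpen_setOf_inter_compact_eq_empty hCc, ⟨x, hxA, mem_interior_iff_mem_nhds.2 hC⟩,
    ?_, ?_⟩
  · exact disjoint_iff_inter_eq_empty.1 (subset_compl_iff_disjoint_left.1 hCB)
  · rintro A' ⟨y, hyA, hyC⟩ B' hB hle
    exact (hB ▸ ⟨hle hyA, interior_subset hyC⟩ : y ∈ (∅ : Set X))

theorem t2Space_fellTop [LocallyCompactSpace X] : T2Space (Closeds X) := by
  refine ⟨fun A B hAB => ?_⟩
  by_cases h : A ≤ B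
  · obtain ⟨U, V, hU, hV, hBU, hAV, hUV⟩ :=
      exists_isOpen_separating_of_not_le fun h' => hAB (le_antisymm h h')
    exact ⟨V, U, hV, hU, hAV, hBU, disjoint_left.2 fun D hDV hDU => hUV D hDU D hDV le_rfl⟩
  · obtain ⟨U, V, hU, hV, hAU, hBV, hUV⟩ := exists_isOpen_separating_of_not_le h
    exact ⟨U, V, hU, hV, hAU, hBV, disjoint_left.2 fun D hDU hDV => hUV D hDU D hDV le_rfl⟩

theorem isClosed_setOf_fst_le_snd [LocallyCompactSpace X] :
    IsClosed {p : Closeds X × Closeds X | p.1 ≤ p.2} := by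
  refine isOpen_compl_iff.1 (isOpen_iff_mem_nhds.2 fun p hp => ?_)
  obtain ⟨U, V, hU, hV, h₁, h₂, hUV⟩ := exists_isOpen_separating_of_not_le hp
  filter_upwards [prod_mem_nhds (hU.mem_nhds h₁) (hV.mem_nhds h₂)] with q hq
  exact hUV _ hq.1 _ hq.2

theorem isLimitSet_iff_forall_finset {L : Set X} :
    IsLimitSet L ↔ ∀ Φ : Finset (Set X), (∀ O ∈ Φ, IsOpen O) →
      (∀ O ∈ Φ, (L ∩ O).Nonempty) → (⋂ O ∈ Φ, O).Nonempty := by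
  constructor
  · rintro ⟨F, hF, hL⟩ Φ hΦ hLΦ
    refine F.nonempty_of_mem ((Filter.biInter_finset_mem Φ).2 fun O hO => ?_)
    obtain ⟨x, hxL, hxO⟩ := hLΦ O hO
    exact hL x hxL ((hΦ O hO).mem_nhds hxO)
  · intro h
    refine ⟨Filter.generate {O | IsOpen O ∧ (L ∩ O).Nonempty}, ?_, ?_⟩
    · refine Filter.generate_neBot_iff.2 fun t ht htf => ?_
      have := h htf.toFinset (fun O hO => (ht (htf.mem_toFinset.1 hO)).1)
        (fun O hO => (ht (htf.mem_toFinset.1 hO)).2)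
      simpa [sInter_eq_biInter] using this
    · intro x hx s hs
      obtain ⟨O, hOs, hO, hxO⟩ := mem_nhds_iff.1 hs
      exact mem_of_superset (Filter.mem_generate_of_mem ⟨hO, x, hx, hxO⟩) hOs

theorem IsLimitSet.closure {L : Set X} (hL : IsLimitSet L) : IsLimitSet (closure L) := by
  obtain ⟨F, hF, hL⟩ := hL
  refine ⟨F, hF, fun x hx s hs => ?_⟩
  obtain ⟨O, hOs, hO, hxO⟩ := mem_nhds_iff.1 hs
  obtain ⟨y, hyO, hyL⟩ := mem_closure_iff.1 hx O hO hxO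
  exact mem_of_superset (hL y hyL (hO.mem_nhds hyO)) hOs

theorem isClosed_setOf_isLimitSet : IsClosed {A : Closeds X | IsLimitSet (A : Set X)} := by
  refine isClosed_of_closure_subset fun A hA => isLimitSet_iff_forall_finset.2 fun Φ hΦ hAΦ => ?_
  obtain ⟨B, hBΦ, hB⟩ :=
    mem_closure_iff.1 hA _ (isOpen_setOf_forall_inter_nonempty hΦ) hAΦ
  exact isLimitSet_iff_forall_finset.1 hB Φ hΦ hBΦ

theorem isMaxLimitSet_iff_isMax (A : LX X) : IsMaxLimitSet (A.1 : Set X) ↔ IsMax A := by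
  constructor
  · intro hA B hAB
    exact (hA.2 _ B.2 hAB).le
  · refine fun hA => ⟨A.2, fun M hM hAM => Subset.antisymm ?_ hAM⟩
    exact subset_closure.trans
      (@hA ⟨⟨closure M, isClosed_closure⟩, hM.closure⟩ (hAM.trans subset_closure))

theorem exists_countable_isCompact_subset_isOpen (X : Type u) [TopologicalSpace X]
    [SecondCountableTopology X] [LocallyCompactSpace X] :
    ∃ S : Set (Set X × Set X), S.Countable ∧
      (∀ p ∈ S, IsCompact p.1 ∧ IsOpen p.2 ∧ p.1 ⊆ p.2) ∧
      ∀ (x : X) (U : Set X), IsOpen U → x ∈ U → ∃ p ∈ S, x ∈ p.1 ∧ p.2 ⊆ U := by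
  have hbasis := isBasis_countableBasis X
  let T : Set (Set X × Set X) := {q ∈ countableBasis X ×ˢ countableBasis X |
    ∃ C, IsCompact C ∧ q.1 ⊆ C ∧ C ⊆ q.2}
  have hT : ∀ q : T, ∃ C, IsCompact C ∧ q.1.1 ⊆ C ∧ C ⊆ q.1.2 := fun q => q.2.2
  choose K hKc hK₁ hK₂ using hT
  have hTc : T.Countable :=
    ((countable_countableBasis X).prod (countable_countableBasis X)).mono (sep_subset _ _)
  have := hTc.to_subtype
  refine ⟨range fun q : T => (K q, q.1.2), countable_range _, ?_, ?_⟩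
  · rintro _ ⟨q, rfl⟩
    exact ⟨hKc q, hbasis.isOpen q.2.1.2, hK₂ q⟩
  · intro x U hU hxU
    obtain ⟨W, hW, hxW, hWU⟩ := hbasis.exists_subset_of_mem_open hxU hU
    obtain ⟨C, hC, hCW, hCc⟩ := local_compact_nhds ((hbasis.isOpen hW).mem_nhds hxW)
    obtain ⟨V, hV, hxV, hVC⟩ := hbasis.mem_nhds_iff.1 hC
    let q : T := ⟨(V, W), ⟨hV, hW⟩, C, hCc, hVC, hCW⟩
    exact ⟨_, ⟨q, rfl⟩, hK₁ q hxV, hWU⟩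

theorem isGδ_setOf_isMaxLimitSet [SecondCountableTopology X] [LocallyCompactSpace X] :
    IsGδ {A : LX X | IsMaxLimitSet (A.1 : Set X)} := by
  have := compactSpace_fellTop (X := X)
  have : CompactSpace (LX X) :=
    isCompact_iff_compactSpace.1 (isClosed_setOf_isLimitSet (X := X)).isCompact
  obtain ⟨S, hSc, hS, hSx⟩ := exists_countable_isCompact_subset_isOpen X
  let E (p : Set X × Set X) : Set (LX X × LX X) :=
    {q | q.1 ≤ q.2 ∧ ¬ ((q.1.1 : Set X) ∩ p.2).Nonempty ∧ (q.2.1 : Set X) ∩ p.1 ≠ ∅}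
  have hE : ∀ p ∈ S, IsClosed (Prod.fst '' E p) := fun p hp =>
    isClosedMap_fst_of_compactSpace _ <|
      (isClosed_setOf_fst_le_snd.preimage
        (by fun_prop : Continuous fun q : LX X × LX X => (q.1.1, q.2.1))).inter <|
      ((isOpen_setOf_inter_open_nonempty (hS p hp).2.1).preimage
        (by fun_prop : Continuous fun q : LX X × LX X => q.1.1)).isClosed_compl.inter
      ((isOpen_setOf_inter_compact_eq_empty (hS p hp).1).preimage
        (by fun_prop : Continuous fun q : LX X × LX X => q.2.1)).isClosed_compl
  suffices h : {A : LX X | IsMaxLimitSet (A.1 : Set X)} = ⋂ p ∈ S, (Prod.fst '' E p)ᶜ by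
    rw [h]
    exact .biInter hSc fun p hp => (hE p hp).isOpen_compl.isGδ
  ext A
  simp only [mem_ofPred_eq, isMaxLimitSet_iff_isMax, mem_iInter, mem_compl_iff]
  constructor
  · rintro hA p hp ⟨⟨_, M⟩, ⟨hle, hU, hC⟩, rfl⟩
    obtain ⟨x, hxM, hxC⟩ := nonempty_iff_ne_empty.2 hC
    exact hU ⟨x, hA hle hxM, (hS p hp).2.2 hxC⟩
  · intro h M hAM
    by_contra hMA
    obtain ⟨x, hxM, hxA⟩ := not_subset.1 hMA
    obtain ⟨p, hp, hxp, hpA⟩ := hSx x _ A.1.isClosed.isOpen_compl hxA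
    exact h p hp ⟨(A, M), ⟨hAM, fun ⟨y, hyA, hyp⟩ => hpA hyp hyA,
      nonempty_iff_ne_empty.1 ⟨x, hxM, hxp⟩⟩, rfl⟩

end FellTopology

/-- if `X` is second countable and locally compact then `ML(X)` with the
topology induced by the Fell topology `τ_s` is a Baire space. -/
theorem ML_fell_baire {X : Type u} [TopologicalSpace X] [SecondCountableTopology X]
    [LocallyCompactSpace X] :
    @BaireSpace (MLX X) (fellTopML X) := by
  let : TopologicalSpace (Closeds X) := fellTop X
  have := compactSpace_fellTop (X := X)
  have := t2Space_fellTop (X := X)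
  have : CompactSpace (LX X) :=
    isCompact_iff_compactSpace.1 (isClosed_setOf_isLimitSet (X := X)).isCompact
  have := (isGδ_setOf_isMaxLimitSet (X := X)).baireSpace_of_t2Space_locallyCompactSpace
  let e : {A : LX X | IsMaxLimitSet (A.1 : Set X)} ≃ₜ MLX X :=
    { toFun := fun A => ⟨A.1.1, A.2⟩
      invFun := fun A => ⟨⟨A.1, A.2.1⟩, A.2⟩
      continuous_toFun := by fun_prop
      continuous_invFun := by fun_prop }
  exact e.baireSpace
end

section
/- Let X be a topological space and let η_X : X → F(X) be the map η_X(x) = closure({x}). Then the closure of the image η_X(X) in (F(X), τ_w) is exactly L(X); more precisely, a closed set A ⊆ X belongs to the τ_w-closure of η_X(X) if and only if every finite family of open subsets of X, each of which meets A, has nonempty intersection, i.e., if and only if A is a limit set. -/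
open Filter Set Topology TopologicalSpace

universe u v

/-- The generating sets of `lowTop` are closed under finite intersections, hence form a basis. -/
theorem isTopologicalBasis_lowTop (X : Type u) [TopologicalSpace X] :
    @IsTopologicalBasis (Closeds X) (lowTop X)
      {U | ∃ Φ : Finset (Set X), (∀ O ∈ Φ, IsOpen O) ∧
        U = {A : Closeds X | ∀ O ∈ Φ, ((A : Set X) ∩ O).Nonempty}} := by
  classical
  let _ := lowTop X
  refine ⟨?_, ?_, rfl⟩
  · rintro _ ⟨Φ, hΦ, rfl⟩ _ ⟨Ψ, hΨ, rfl⟩ A ⟨hAΦ, hAΨ⟩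
    refine ⟨_, ⟨Φ ∪ Ψ, fun O hO ↦ ?_, rfl⟩, fun O hO ↦ ?_,
      fun B hB ↦ ⟨fun O hO ↦ ?_, fun O hO ↦ ?_⟩⟩
    · exact (Finset.mem_union.1 hO).elim (hΦ O) (hΨ O)
    · exact (Finset.mem_union.1 hO).elim (hAΦ O) (hAΨ O)
    · exact hB O (Finset.mem_union_left _ hO)
    · exact hB O (Finset.mem_union_right _ hO)
  · exact eq_univ_of_forall fun A ↦ ⟨univ, ⟨∅, by simp, by simp⟩, mem_univ A⟩

/-- An open set meets the closure of a point iff it contains the point. -/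
theorem IsOpen.closure_singleton_inter_nonempty_iff {X : Type u} [TopologicalSpace X] {O : Set X}
    (hO : IsOpen O) (x : X) : (closure {x} ∩ O).Nonempty ↔ x ∈ O := by
  rw [closure_inter_open_nonempty_iff hO, singleton_inter_nonempty]

theorem mem_closure_range_eta_iff {X : Type u} [TopologicalSpace X] (A : Closeds X) :
    A ∈ @closure (Closeds X) (lowTop X)
        (Set.range fun x : X => (⟨closure {x}, isClosed_closure⟩ : Closeds X)) ↔
      ∀ Φ : Finset (Set X), (∀ O ∈ Φ, IsOpen O ∧ ((A : Set X) ∩ O).Nonempty) →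
        (⋂₀ (↑Φ : Set (Set X))).Nonempty := by
  rw [@IsTopologicalBasis.mem_closure_iff _ (lowTop X) _ (isTopologicalBasis_lowTop X)]
  constructor
  · intro h Φ hΦ
    obtain ⟨_, hx, x, rfl⟩ := h _ ⟨Φ, fun O hO ↦ (hΦ O hO).1, rfl⟩ fun O hO ↦ (hΦ O hO).2
    exact ⟨x, fun O hO ↦ ((hΦ O hO).1.closure_singleton_inter_nonempty_iff x).1 (hx O hO)⟩
  · rintro h _ ⟨Φ, hΦ, rfl⟩ hA
    obtain ⟨x, hx⟩ := h Φ fun O hO ↦ ⟨hΦ O hO, hA O hO⟩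
    exact ⟨_, fun O hO ↦ ((hΦ O hO).closure_singleton_inter_nonempty_iff x).2 (hx O hO), x, rfl⟩

/-- A set is a limit set iff the open sets meeting it have the finite intersection property. -/
theorem isLimitSet_iff_finite_inter {X : Type u} [TopologicalSpace X] (L : Set X) :
    IsLimitSet L ↔ ∀ Φ : Finset (Set X), (∀ O ∈ Φ, IsOpen O ∧ (L ∩ O).Nonempty) →
      (⋂₀ (↑Φ : Set (Set X))).Nonempty := by
  constructor
  · rintro ⟨F, hF, hFL⟩ Φ hΦ
    refine hF.nonempty_of_mem ((sInter_mem Φ.finite_toSet).2 fun O hO ↦ ?_)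
    obtain ⟨hOpen, x, hxL, hxO⟩ := hΦ O hO
    exact hFL x hxL (hOpen.mem_nhds hxO)
  · intro h
    refine ⟨generate {O | IsOpen O ∧ (L ∩ O).Nonempty}, generate_neBot_iff.2 fun t ht hfin ↦ ?_,
      fun x hx s hs ↦ ?_⟩
    · simpa using h hfin.toFinset fun O hO ↦ ht (hfin.mem_toFinset.1 hO)
    · obtain ⟨O, hOs, hO, hxO⟩ := mem_nhds_iff.1 hs
      exact mem_of_superset (mem_generate_of_mem ⟨hO, x, hx, hxO⟩) hOs

/-- the `τ_w`-closure of the image of `η_X : x ↦ closure {x}` in `F(X)`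
is exactly `L(X)`; more precisely, a closed set `A` lies in this closure iff every
finite family of open sets each meeting `A` has nonempty intersection, iff `A` is a
limit set. -/
theorem closure_range_eta {X : Type u} [TopologicalSpace X] :
    @closure (Closeds X) (lowTop X)
        (Set.range fun x : X => (⟨closure {x}, isClosed_closure⟩ : Closeds X))
      = {A : Closeds X | IsLimitSet (A : Set X)} ∧
    ∀ A : Closeds X,
      (A ∈ @closure (Closeds X) (lowTop X)
          (Set.range fun x : X => (⟨closure {x}, isClosed_closure⟩ : Closeds X)) ↔
        ∀ Φ : Finset (Set X), (∀ O ∈ Φ, IsOpen O ∧ ((A : Set X) ∩ O).Nonempty) →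
          (⋂₀ (↑Φ : Set (Set X))).Nonempty) ∧
      (A ∈ @closure (Closeds X) (lowTop X)
          (Set.range fun x : X => (⟨closure {x}, isClosed_closure⟩ : Closeds X)) ↔
        IsLimitSet (A : Set X)) := by
  have h (A : Closeds X) := (mem_closure_range_eta_iff A).trans
    (isLimitSet_iff_finite_inter (A : Set X)).symm
  exact ⟨Set.ext h, fun A ↦ ⟨mem_closure_range_eta_iff A, h A⟩⟩
end
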